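/- Let n ≥ 4. Suppose that every a ∈ F_{2^n} with K_n(a) ≡ 0 (mod 16) satisfies Tr(a) = 0 and Q(a) = 0 (and conversely), where Q(x) = Σ_{0 ≤ i < j < n} x^{2^i+2^j}. Then any F_2-subspace W of F_{2^n} with K_n(w) ≡ 0 (mod 16) for all w ∈ W satisfies dim W ≤ d, where d = (n-2)/2 if n ≡ 0,2,6 (mod 8), d = (n-1)/2 if n ≡ 1,7 (mod 8), d = (n-3)/2 if n ≡ 3,5 (mod 8), and d = n/2 if n ≡ 4 (mod 8). -/

import Mathlib

noncomputable section

abbrev K (n : ℕ) := GaloisField 2 n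

noncomputable instance (n : ℕ) : Fintype (K n) := Fintype.ofFinite _

/-- The absolute trace of `F_{2^n}` to `F_2`. -/
def tr (n : ℕ) : K n →ₗ[ZMod 2] ZMod 2 := Algebra.trace (ZMod 2) (K n)

/-- The additive character `x ↦ (-1)^{Tr(x)}`. -/
def chi (n : ℕ) (x : K n) : ℤ := (-1) ^ (tr n x).val

/-- The Kloosterman sum. -/
def Kl (n : ℕ) (a : K n) : ℤ := ∑ x : K n, chi n (x⁻¹ + a * x)

/-- The quadratic form `Q(x) = ∑_{0 ≤ i < j < n} x^{2^i + 2^j}`. -/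
def Qf (n : ℕ) (x : K n) : K n := ∑ i ∈ Finset.range n, ∑ j ∈ Finset.Ioo i n, x ^ (2^i + 2^j)

/-- The partial trace `∑_{i < k} x^{2^i}`. -/
def psum {R : Type*} [CommRing R] (k : ℕ) (x : R) : R := ∑ i ∈ Finset.range k, x ^ 2 ^ i

/-- The partial quadratic sum `∑_{i < j < k} x^{2^i + 2^j}`. -/
def qsum {R : Type*} [CommRing R] (k : ℕ) (x : R) : R :=
  ∑ i ∈ Finset.range k, ∑ j ∈ Finset.Ioo i k, x ^ (2 ^ i + 2 ^ j)

section PartialSums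

variable {R : Type*} [CommRing R]

@[simp] lemma psum_zero (x : R) : psum 0 x = 0 := by simp [psum]

@[simp] lemma qsum_zero (x : R) : qsum 0 x = 0 := by simp [qsum]

lemma psum_succ (k : ℕ) (x : R) : psum (k + 1) x = psum k x + x ^ 2 ^ k :=
  Finset.sum_range_succ _ _

lemma qsum_succ (k : ℕ) (x : R) : qsum (k + 1) x = qsum k x + psum k x * x ^ 2 ^ k := by
  have h : ∀ i ∈ Finset.range k, ∑ j ∈ Finset.Ioo i (k + 1), x ^ (2 ^ i + 2 ^ j) =
      ∑ j ∈ Finset.Ioo i k, x ^ (2 ^ i + 2 ^ j) + x ^ 2 ^ i * x ^ 2 ^ k := by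
    intro i hi
    have hi' : i < k := Finset.mem_range.mp hi
    have : Finset.Ioo i (k + 1) = insert k (Finset.Ioo i k) := by
      ext j; simp only [Finset.mem_Ioo, Finset.mem_insert]; omega
    rw [this, Finset.sum_insert (by simp), ← pow_add, add_comm]
  have h' : Finset.Ioo k (k + 1) = ∅ := by
    ext j; simp only [Finset.mem_Ioo, Finset.notMem_empty, iff_false]; omega
  rw [qsum, Finset.sum_range_succ, Finset.sum_congr rfl h, h', Finset.sum_empty, add_zero,
    Finset.sum_add_distrib, ← Finset.sum_mul]
  rfl

lemma psum_add (a b : ℕ) (x : R) : psum (a + b) x = psum a x + psum b (x ^ 2 ^ a) := by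
  induction b with
  | zero => simp
  | succ b ih => rw [← add_assoc, psum_succ, ih, psum_succ, ← pow_mul, ← pow_add, add_assoc]

lemma qsum_add (a b : ℕ) (x : R) :
    qsum (a + b) x = qsum a x + qsum b (x ^ 2 ^ a) + psum a x * psum b (x ^ 2 ^ a) := by
  induction b with
  | zero => simp
  | succ b ih =>
    rw [← add_assoc, qsum_succ, ih, qsum_succ, psum_succ, psum_add, ← pow_mul, ← pow_add]
    ring

lemma psum_one (k : ℕ) : psum k (1 : R) = k := by simp [psum]

lemma psum_map {S : Type*} [CommRing S] (φ : R →+* S) (k : ℕ) (x : R) :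
    psum k (φ x) = φ (psum k x) := by simp [psum]

lemma qsum_map {S : Type*} [CommRing S] (φ : R →+* S) (k : ℕ) (x : R) :
    qsum k (φ x) = φ (qsum k x) := by simp [qsum]

lemma psum_mul_of_fixed {m : ℕ} {x : R} (hx : x ^ 2 ^ m = x) (k : ℕ) :
    psum (m * k) x = k * psum m x := by
  induction k with
  | zero => simp
  | succ k ih => rw [mul_add_one, add_comm, psum_add, hx, ih]; push_cast; ring

lemma qsum_mul_of_fixed {m : ℕ} {x : R} (hx : x ^ 2 ^ m = x) (hp : psum m x = 0) (k : ℕ) :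
    qsum (m * k) x = k * qsum m x := by
  induction k with
  | zero => simp
  | succ k ih => rw [mul_add_one, add_comm, qsum_add, hx, ih, hp]; push_cast; ring

variable [CharP R 2]

lemma psum_add_right (k : ℕ) (x y : R) : psum k (x + y) = psum k x + psum k y := by
  simp only [psum, add_pow_char_pow, Finset.sum_add_distrib]

lemma qsum_add_right (k : ℕ) (x y : R) :
    qsum k (x + y) = qsum k x + qsum k y + psum k x * psum k y + psum k (x * y) := by
  induction k with
  | zero => simp
  | succ k ih =>
    simp only [qsum_succ, psum_succ, ih, psum_add_right, add_pow_char_pow, mul_pow]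
    linear_combination -(x ^ 2 ^ k * y ^ 2 ^ k) * CharTwo.two_eq_zero (R := R)

lemma psum_sq (k : ℕ) (x : R) : psum k x ^ 2 = psum k (x ^ 2) := by
  simp only [psum, sum_pow_char, ← pow_mul, mul_comm]

lemma psum_sq_add (k : ℕ) (x : R) : psum k x ^ 2 + psum k x = x ^ 2 ^ k + x := by
  have h1 := psum_add 1 k x
  have h2 := psum_succ k x
  rw [add_comm, h2] at h1
  rw [psum_sq]
  simp only [psum_succ, psum_zero, pow_zero, pow_one, zero_add] at h1
  linear_combination -h1 + (psum k x - x) * CharTwo.two_eq_zero (R := R)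

lemma qsum_sq {k : ℕ} {x : R} (hx : x ^ 2 ^ k = x) : qsum k x ^ 2 = qsum k x := by
  have h0 : qsum k x ^ 2 = qsum k (x ^ 2) := by
    simp only [qsum, sum_pow_char, ← pow_mul, mul_comm]
  have h1 := qsum_add 1 k x
  have h2 := qsum_succ k x
  have h3 := psum_sq_add k x
  rw [add_comm, h2, hx] at h1
  rw [hx, psum_sq] at h3
  simp only [psum_succ, qsum_succ, psum_zero, qsum_zero, pow_zero, pow_one, zero_add, zero_mul]
    at h1
  rw [h0]
  linear_combination -h1 - x * h3 + (x * psum k x - x * x) * CharTwo.two_eq_zero (R := R)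

end PartialSums

lemma card_K {n : ℕ} (hn : n ≠ 0) : Fintype.card (K n) = 2 ^ n := by
  rw [← Nat.card_eq_fintype_card]; exact GaloisField.card 2 n hn

lemma finrank_K {n : ℕ} (hn : n ≠ 0) : Module.finrank (ZMod 2) (K n) = n :=
  GaloisField.finrank 2 hn

lemma pow_card_K {n : ℕ} (hn : n ≠ 0) (x : K n) : x ^ 2 ^ n = x := by
  rw [← card_K hn]; exact FiniteField.pow_card x

lemma algebraMap_tr {n : ℕ} (hn : n ≠ 0) (x : K n) :
    algebraMap (ZMod 2) (K n) (tr n x) = psum n x := by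
  rw [tr, FiniteField.algebraMap_trace_eq_sum_pow, finrank_K hn, psum]
  simp

lemma Qf_eq_qsum (n : ℕ) (x : K n) : Qf n x = qsum n x := rfl

open scoped Classical in
/-- The quadratic form `Qf`, with values in the prime field. -/
def qf (n : ℕ) (x : K n) : ZMod 2 := if Qf n x = 0 then 0 else 1

lemma qf_eq_zero_iff {n : ℕ} {x : K n} : qf n x = 0 ↔ Qf n x = 0 := by
  simp [qf]

lemma algebraMap_qf {n : ℕ} (hn : n ≠ 0) (x : K n) :
    algebraMap (ZMod 2) (K n) (qf n x) = Qf n x := by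
  have h : Qf n x * (Qf n x - 1) = 0 := by
    have := qsum_sq (pow_card_K hn x)
    rw [Qf_eq_qsum]; linear_combination this
  rw [qf]
  split_ifs with h0
  · simp [h0]
  · rw [map_one, sub_eq_zero.mp ((mul_eq_zero.mp h).resolve_left h0)]

lemma qf_add {n : ℕ} (hn : n ≠ 0) (x y : K n) :
    qf n (x + y) = qf n x + qf n y + tr n x * tr n y + tr n (x * y) := by
  apply (algebraMap (ZMod 2) (K n)).injective
  simp only [map_add, map_mul, algebraMap_qf hn, algebraMap_tr hn, Qf_eq_qsum, qsum_add_right]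

lemma tr_mul_self {n : ℕ} (hn : n ≠ 0) (x : K n) : tr n (x * x) = tr n x := by
  apply (algebraMap (ZMod 2) (K n)).injective
  have h := psum_sq_add n x
  rw [pow_card_K hn, CharTwo.add_self_eq_zero, CharTwo.add_eq_zero] at h
  rw [algebraMap_tr hn, algebraMap_tr hn, ← pow_two, ← psum_sq, h]

lemma finrank_orthogonal_tr {n : ℕ} (hn : n ≠ 0) (V : Submodule (ZMod 2) (K n)) :
    Module.finrank (ZMod 2) ((Algebra.traceForm (ZMod 2) (K n)).orthogonal V) =
      n - Module.finrank (ZMod 2) V := by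
  rw [LinearMap.BilinForm.finrank_orthogonal (traceForm_nondegenerate _ _), finrank_K hn]

lemma two_mul_finrank_le {n : ℕ} (hn : n ≠ 0) (V : Submodule (ZMod 2) (K n))
    (hV : ∀ x ∈ V, ∀ y ∈ V, tr n (x * y) = 0) : 2 * Module.finrank (ZMod 2) V ≤ n := by
  have h1 : V ≤ (Algebra.traceForm (ZMod 2) (K n)).orthogonal V := fun x hx y hy => hV y hy x hx
  have h2 := Submodule.finrank_mono h1
  have h3 := Submodule.finrank_le V
  rw [finrank_orthogonal_tr hn] at h2
  rw [finrank_K hn] at h3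
  omega

lemma mem_of_tr_mul_eq_zero {n : ℕ} (hn : n ≠ 0) (V : Submodule (ZMod 2) (K n))
    (hV : ∀ x ∈ V, ∀ y ∈ V, tr n (x * y) = 0) (hd : n ≤ 2 * Module.finrank (ZMod 2) V + 1)
    (x : K n) (hx : tr n x = 0) (hxV : ∀ w ∈ V, tr n (x * w) = 0) : x ∈ V := by
  by_contra hxm
  have hsup : ∀ y ∈ V ⊔ Submodule.span (ZMod 2) {x}, ∀ z ∈ V ⊔ Submodule.span (ZMod 2) {x},
      tr n (y * z) = 0 := by
    intro y hy z hz
    obtain ⟨v, hv, a, ha, rfl⟩ := Submodule.mem_sup.mp hy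
    obtain ⟨w, hw, b, hb, rfl⟩ := Submodule.mem_sup.mp hz
    obtain ⟨r, rfl⟩ := Submodule.mem_span_singleton.mp ha
    obtain ⟨s, rfl⟩ := Submodule.mem_span_singleton.mp hb
    simp [add_mul, mul_add, hV v hv w hw, mul_comm v x, hxV v hv, hxV w hw, tr_mul_self hn, hx]
  have h1 := two_mul_finrank_le hn _ hsup
  have h2 : V < V ⊔ Submodule.span (ZMod 2) {x} := by
    refine lt_of_le_of_ne le_sup_left fun h => hxm ?_
    rw [h]
    exact Submodule.mem_sup_right (Submodule.mem_span_singleton_self x)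
  have h3 := Submodule.finrank_lt_finrank_of_lt h2
  omega

/-- The nontrivial additive character of `ZMod 2`. -/
def sgn (a : ZMod 2) : ℤ := if a = 0 then 1 else -1

lemma sgn_add (a b : ZMod 2) : sgn (a + b) = sgn a * sgn b := by
  revert a b; decide

lemma sgn_mul_self (a : ZMod 2) : sgn a * sgn a = 1 := by
  revert a; decide

noncomputable instance {n : ℕ} (V : Submodule (ZMod 2) (K n)) : Fintype V := Fintype.ofFinite _

open scoped Classical in
lemma sum_sgn {n : ℕ} (V : Submodule (ZMod 2) (K n)) (z : K n) :
    ∑ w : V, sgn (tr n (z * w)) =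
      if ∀ w ∈ V, tr n (z * w) = 0 then (Fintype.card V : ℤ) else 0 := by
  split_ifs with h
  · rw [Finset.sum_congr rfl fun w _ => by rw [h w w.2]]
    simp [sgn]
  · push Not at h
    obtain ⟨v, hv, hne⟩ := h
    have h1 : ∑ w : V, sgn (tr n (z * w)) = ∑ w : V, -sgn (tr n (z * w)) := by
      refine Fintype.sum_equiv (Equiv.addRight ⟨v, hv⟩) _ _ fun w => ?_
      have hv1 : sgn (tr n (z * v)) = -1 := by simp [sgn, hne]
      simp [mul_add, sgn_add, hv1]
    rw [Finset.sum_neg_distrib] at h1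
    linarith

/-- The exponential sum of the quadratic form on the trace-zero hyperplane. -/
def qSum (n : ℕ) : ℤ := ∑ x : LinearMap.ker (tr n), sgn (qf n x)

lemma qSum_mul_sgn_pos {n : ℕ} (hn : n ≠ 0) (V : Submodule (ZMod 2) (K n)) (c : K n)
    (hc : tr n c = 0) (hVt : ∀ w ∈ V, tr n w = 0) (hVc : ∀ w ∈ V, qf n w = tr n (c * w))
    (hQ : ∀ x, tr n x = 0 → (∀ w ∈ V, tr n ((x + c) * w) = 0) → qf n x = qf n c) :
    0 < qSum n * sgn (qf n c) := by
  classical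
  have h1 : ∀ w : V, qSum n = ∑ x : LinearMap.ker (tr n), sgn (qf n x) *
      sgn (tr n ((x + c) * w)) := by
    intro w
    symm
    refine Fintype.sum_equiv (Equiv.addRight (⟨w, hVt w w.2⟩ : LinearMap.ker (tr n))) _ _
      fun x => ?_
    rw [← sgn_add]
    simp [qf_add hn, hVt w w.2, hVc w w.2, add_mul]
    ring_nf
  have h2 : qSum n * Fintype.card V = ∑ x : LinearMap.ker (tr n), sgn (qf n x) *
      (if ∀ w ∈ V, tr n ((x + c) * w) = 0 then (Fintype.card V : ℤ) else 0) := by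
    simp_rw [← sum_sgn, Finset.mul_sum]
    rw [Finset.sum_comm, ← Finset.sum_congr rfl fun w _ => h1 w]
    simp [mul_comm]
  have hcard : 0 < (Fintype.card V : ℤ) := by exact_mod_cast Fintype.card_pos
  have h3 : 0 < qSum n * sgn (qf n c) * Fintype.card V := by
    rw [mul_right_comm, h2, Finset.sum_mul]
    refine Finset.sum_pos' (fun x _ => ?_) ⟨⟨c, hc⟩, Finset.mem_univ _, ?_⟩
    · split_ifs with h
      · rw [hQ x x.2 h, mul_right_comm, sgn_mul_self]
        positivity
      · simp
    · simp [CharTwo.add_self_eq_zero, mul_right_comm, sgn_mul_self, Fintype.card_pos]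
  exact pos_of_mul_pos_left h3 hcard.le

lemma qSum_neg_of_mod_eight_eq_zero {n : ℕ} (hn : n ≠ 0) (h8 : n % 8 = 0) : qSum n < 0 := by
  obtain ⟨m, hnm⟩ : ∃ m, n = m + m := ⟨n / 2, by omega⟩
  have hm : (m : K n) = 0 := by
    rw [CharP.cast_eq_zero_iff _ 2]; omega
  have hpsum : ∀ x : K n, psum n x = psum m x + psum m (x ^ 2 ^ m) := fun x => by
    rw [← psum_add, ← hnm]
  have hqsum : ∀ x : K n, qsum n x =
      qsum m x + qsum m (x ^ 2 ^ m) + psum m x * psum m (x ^ 2 ^ m) := fun x => by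
    rw [← qsum_add, ← hnm]
  let φ : K n →ₗ[ZMod 2] K n :=
    { toFun := fun x => x ^ 2 ^ m + x
      map_add' := fun x y => by rw [add_pow_char_pow]; ring
      map_smul' := fun r x => by
        rw [smul_pow, smul_add, RingHom.id_apply]
        congr 2
        fin_cases r
        · exact zero_pow (by positivity)
        · exact one_pow _ }
  have hker : ∀ x, x ∈ LinearMap.ker φ ↔ x ^ 2 ^ m = x := fun x => by
    rw [LinearMap.mem_ker]; exact CharTwo.add_eq_zero
  have hfrob : ∀ x : K n, (x ^ 2 ^ m) ^ 2 ^ m = x := fun x => by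
    rw [← pow_mul, ← pow_add, ← hnm, pow_card_K hn]
  have htr : ∀ x : K n, x ^ 2 ^ m = x → tr n x = 0 := fun x hx => by
    apply (algebraMap (ZMod 2) (K n)).injective
    rw [algebraMap_tr hn, hpsum, hx, CharTwo.add_self_eq_zero, map_zero]
  have hiso : ∀ x ∈ LinearMap.ker φ, ∀ y ∈ LinearMap.ker φ, tr n (x * y) = 0 := by
    intro x hx y hy
    exact htr _ (by rw [mul_pow, (hker x).mp hx, (hker y).mp hy])
  have hle : LinearMap.range φ ≤ LinearMap.ker φ := by
    rintro _ ⟨x, rfl⟩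
    rw [hker]
    change (x ^ 2 ^ m + x) ^ 2 ^ m = x ^ 2 ^ m + x
    rw [add_pow_char_pow, hfrob, add_comm]
  have hd := two_mul_finrank_le hn _ hiso
  have hrn := LinearMap.finrank_range_add_finrank_ker φ
  rw [finrank_K hn] at hrn
  have heq : LinearMap.range φ = LinearMap.ker φ :=
    Submodule.eq_of_le_of_finrank_le hle (by omega)
  have hd' := Submodule.finrank_mono hle
  obtain ⟨c, hc⟩ : (1 : K n) ∈ LinearMap.range φ := by
    rw [heq, hker, one_pow]
  replace hc : c ^ 2 ^ m = c + 1 := by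
    rw [← hc]
    change c ^ 2 ^ m = c + (c ^ 2 ^ m + c)
    linear_combination -c * CharTwo.two_eq_zero (R := K n)
  have hctr : tr n c = 0 := by
    apply (algebraMap (ZMod 2) (K n)).injective
    rw [algebraMap_tr hn, hpsum, hc, psum_add_right, psum_one, hm, add_zero,
      CharTwo.add_self_eq_zero, map_zero]
  have hq1 : qsum m (1 : K n) = 0 := by
    obtain ⟨k, rfl⟩ : ∃ k, m = 4 * k := ⟨m / 4, by omega⟩
    rw [qsum_mul_of_fixed (one_pow _)]
    · have : qsum 4 (1 : K n) = 6 := by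
        simp only [qsum_succ, psum_succ, psum_zero, qsum_zero, one_pow]; norm_num
      rw [this]
      linear_combination 3 * (k : K n) * CharTwo.two_eq_zero (R := K n)
    · rw [psum_one]
      push_cast
      linear_combination 2 * CharTwo.two_eq_zero (R := K n)
  have hqc : qf n c = 1 := by
    apply (algebraMap (ZMod 2) (K n)).injective
    have h := psum_sq_add m c
    rw [hc] at h
    rw [algebraMap_qf hn, Qf_eq_qsum, hqsum, hc, qsum_add_right, psum_add_right, psum_one, hm,
      hq1, mul_one, map_one]
    linear_combination h + (qsum m c + c) * CharTwo.two_eq_zero (R := K n)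
  have hpos := qSum_mul_sgn_pos hn (LinearMap.ker φ) c hctr
    (fun w hw => htr w ((hker w).mp hw)) (fun w hw => ?_) (fun x hx hxw => ?_)
  · rw [hqc] at hpos
    simp [sgn] at hpos
    exact hpos
  · have hw' := (hker w).mp hw
    apply (algebraMap (ZMod 2) (K n)).injective
    have h := psum_sq_add m w
    rw [hw', CharTwo.add_self_eq_zero] at h
    rw [algebraMap_qf hn, algebraMap_tr hn, Qf_eq_qsum, hqsum, hpsum, mul_pow, hc, hw',
      add_mul, one_mul, psum_add_right]
    linear_combination h + (qsum m w - psum m w - psum m (c * w)) * CharTwo.two_eq_zero (R := K n)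
  · have hmem := mem_of_tr_mul_eq_zero hn _ hiso (by omega) (x + c) (by simp [hx, hctr]) hxw
    have hx2 : x = (x + c) + c := by rw [add_assoc, CharTwo.add_self_eq_zero, add_zero]
    have hw' := (hker _).mp hmem
    generalize x + c = w at hmem hx2 hw'
    have h := psum_sq_add m w
    rw [hw', CharTwo.add_self_eq_zero] at h
    rw [hx2, add_comm, qf_add hn, hctr]
    apply (algebraMap (ZMod 2) (K n)).injective
    simp only [map_add, zero_mul, add_zero, algebraMap_qf hn]
    rw [algebraMap_tr hn, Qf_eq_qsum, Qf_eq_qsum, hqsum w, hpsum, mul_pow, hc, hw',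
      add_mul, one_mul, psum_add_right]
    linear_combination h + (qsum m w + psum m (c * w)) * CharTwo.two_eq_zero (R := K n)

lemma sum_modEq_sum_fixedPoints {α : Type*} [Fintype α] [DecidableEq α] {p : ℕ} [Fact p.Prime]
    (σ : α → α) (hσ : σ^[p] = id) (g : α → ℤ) (hg : ∀ x, g (σ x) = g x) :
    ∑ x, g x ≡ ∑ x with σ x = x, g x [ZMOD p] := by
  have hfib : ∀ s : Finset α, ∑ x ∈ s, g x =
      ∑ v ∈ Finset.univ.image g, ((s.filter fun x => g x = v).card : ℤ) * v := by
    intro s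
    rw [← Finset.sum_fiberwise_of_maps_to (s := s) (t := Finset.univ.image g) (g := g)
      fun x _ => Finset.mem_image_of_mem _ (Finset.mem_univ x)]
    refine Finset.sum_congr rfl fun v _ => ?_
    rw [Finset.sum_congr rfl fun x hx => (Finset.mem_filter.mp hx).2]
    simp
  rw [hfib, hfib]
  refine Int.ModEq.sum fun v _ => Int.ModEq.mul_right _ ?_
  let τ : Function.End {x // g x = v} := fun x => ⟨σ x, (hg x).trans x.2⟩
  have hτ : ∀ k : ℕ, ∀ x, (((τ ^ k : Function.End _) x : {x // g x = v}) : α) = σ^[k] x := by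
    intro k
    induction k with
    | zero => intro x; rfl
    | succ k ih =>
      intro x
      rw [pow_succ, Function.iterate_succ_apply]
      exact ih (τ x)
  have hτp : τ ^ p ^ 1 = 1 := by
    funext x
    apply Subtype.ext
    rw [pow_one, hτ, hσ]
    rfl
  have h := Equiv.Perm.card_fixedPoints_modEq hτp
  rw [← Int.natCast_modEq_iff, Fintype.card_subtype] at h
  refine h.trans (congrArg (fun c : ℤ => c % p) ?_)
  rw [← Fintype.card_coe]
  refine congrArg Nat.cast (Fintype.card_congr ⟨fun x => ⟨x.1.1, ?_⟩, fun x => ⟨⟨x.1, ?_⟩, ?_⟩,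
    fun x => rfl, fun x => rfl⟩)
  · have := congrArg Subtype.val x.2
    simpa [x.1.2] using this
  · exact (Finset.mem_filter.mp x.2).2
  · have := (Finset.mem_filter.mp (Finset.mem_filter.mp x.2).1).2
    exact Subtype.ext this

lemma qf_pow {n : ℕ} (k : ℕ) (x : K n) : qf n (x ^ 2 ^ k) = qf n x := by
  have h : Qf n (x ^ 2 ^ k) = Qf n x ^ 2 ^ k := qsum_map (iterateFrobenius (K n) 2 k) n x
  have h' : Qf n x ^ 2 ^ k = 0 ↔ Qf n x = 0 := pow_eq_zero_iff (by positivity)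
  by_cases h0 : Qf n x = 0 <;> simp [qf, h, h', h0]

lemma tr_eq_zero_iff {n : ℕ} (hn : n ≠ 0) {x : K n} : tr n x = 0 ↔ psum n x = 0 := by
  rw [← algebraMap_tr hn]; simp

lemma exists_algHom_eq_of_fixed {m n : ℕ} (hm : m ≠ 0) (φ : K m →ₐ[ZMod 2] K n) {x : K n}
    (hx : x ^ 2 ^ m = x) : ∃ y, φ y = x := by
  classical
  have hne : (Polynomial.X ^ 2 ^ m - Polynomial.X : Polynomial (K n)) ≠ 0 :=
    FiniteField.X_pow_card_pow_sub_X_ne_zero _ hm one_lt_two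
  have hroot : ∀ z : K n,
      z ∈ (Polynomial.X ^ 2 ^ m - Polynomial.X : Polynomial (K n)).roots.toFinset ↔
        z ^ 2 ^ m = z := by
    intro z
    simp [hne, sub_eq_zero]
  have hsub : Finset.univ.image φ ⊆
      (Polynomial.X ^ 2 ^ m - Polynomial.X : Polynomial (K n)).roots.toFinset := by
    intro z hz
    obtain ⟨y, -, rfl⟩ := Finset.mem_image.mp hz
    rw [hroot, ← map_pow, pow_card_K hm]
  have heq := Finset.eq_of_subset_of_card_le hsub (by
    rw [Finset.card_image_of_injective _ (show Function.Injective φ from φ.injective), Finset.card_univ, card_K hm]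
    refine (Multiset.toFinset_card_le _).trans ((Polynomial.card_roots' _).trans ?_)
    rw [FiniteField.X_pow_card_pow_sub_X_natDegree_eq _ hm one_lt_two])
  obtain ⟨y, -, hy⟩ := Finset.mem_image.mp (heq ▸ (hroot x).mpr hx)
  exact ⟨y, hy⟩

lemma qSum_mul_modEq {m p : ℕ} [Fact p.Prime] (hm : m ≠ 0) (hp : Odd p) :
    qSum (m * p) ≡ qSum m [ZMOD p] := by
  classical
  have hp0 : p ≠ 0 := (Fact.out : p.Prime).ne_zero
  obtain ⟨n, hnm⟩ : ∃ n, n = m * p := ⟨_, rfl⟩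
  have hn : n ≠ 0 := by rw [hnm]; positivity
  rw [← hnm]
  obtain ⟨φ⟩ : Nonempty (K m →ₐ[ZMod 2] K n) :=
    FiniteField.nonempty_algHom_of_finrank_dvd (by
      rw [finrank_K hm, finrank_K hn, hnm]; exact dvd_mul_right _ _)
  have hpK : (p : K n) = 1 := by
    obtain ⟨k, rfl⟩ := hp
    push_cast
    linear_combination (k : K n) * CharTwo.two_eq_zero (R := K n)
  let σ : LinearMap.ker (tr n) → LinearMap.ker (tr n) := fun x => ⟨x.1 ^ 2 ^ m, by
    rw [LinearMap.mem_ker, tr_eq_zero_iff hn]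
    have h : psum n (x.1 ^ 2 ^ m) = psum n x.1 ^ 2 ^ m :=
      psum_map (iterateFrobenius (K n) 2 m) n x.1
    rw [h, (tr_eq_zero_iff hn).mp x.2, zero_pow (by positivity)]⟩
  have hiter : ∀ k : ℕ, ∀ x, ((σ^[k] x : LinearMap.ker (tr n)) : K n) = x.1 ^ 2 ^ (m * k) := by
    intro k
    induction k with
    | zero => intro x; simp
    | succ k ih =>
      intro x
      rw [Function.iterate_succ_apply, ih, ← pow_mul, ← pow_add, mul_add_one, add_comm]
  have hσ : σ^[p] = id := by
    funext x
    apply Subtype.ext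
    rw [hiter, ← hnm, pow_card_K hn, id]
  refine (sum_modEq_sum_fixedPoints σ hσ (fun x => sgn (qf n x)) fun x => ?_).trans
    (congrArg (fun c : ℤ => c % p) ?_)
  · exact congrArg sgn (qf_pow m x.1)
  have hps : ∀ y : K m, psum n (φ y) = φ (psum m y) := fun y => by
    have hy : φ y ^ 2 ^ m = φ y := by rw [← map_pow, pow_card_K hm]
    have h := psum_mul_of_fixed hy p
    rw [hpK, one_mul, ← hnm] at h
    exact h.trans (psum_map (φ : K m →+* K n) m y)
  have htr : ∀ y : K m, tr n (φ y) = 0 ↔ tr m y = 0 := fun y => by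
    rw [tr_eq_zero_iff hn, tr_eq_zero_iff hm, hps, map_eq_zero]
  have hqf : ∀ y : K m, tr m y = 0 → qf n (φ y) = qf m y := fun y hy => by
    have hy' : φ y ^ 2 ^ m = φ y := by rw [← map_pow, pow_card_K hm]
    have h0 : psum m (φ y) = 0 := by
      rw [tr_eq_zero_iff hm] at hy
      exact (psum_map (φ : K m →+* K n) m y).trans (by rw [hy, map_zero])
    have h := qsum_mul_of_fixed hy' h0 p
    rw [hpK, one_mul, ← hnm] at h
    have h' : Qf n (φ y) = φ (Qf m y) := h.trans (qsum_map (φ : K m →+* K n) m y)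
    simp [qf, h']
  symm
  refine Finset.sum_bij (fun y _ => ⟨φ y, (htr y).mpr y.2⟩) (fun y _ => ?_) (fun y _ z _ h => ?_)
    (fun x hx => ?_) (fun y _ => ?_)
  · refine Finset.mem_filter.mpr ⟨Finset.mem_univ _, Subtype.ext ?_⟩
    change φ y ^ 2 ^ m = φ y
    rw [← map_pow, pow_card_K hm]
  · exact Subtype.ext (φ.injective (congrArg Subtype.val h))
  · have hx' : x.1 ^ 2 ^ m = x.1 := congrArg Subtype.val (Finset.mem_filter.mp hx).2
    obtain ⟨y, hy⟩ := exists_algHom_eq_of_fixed hm φ hx'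
    refine ⟨⟨y, (htr y).mp (by rw [hy]; exact x.2)⟩, Finset.mem_univ _, Subtype.ext hy⟩
  · exact congrArg sgn (hqf y y.2).symm

lemma qSum_sq {n : ℕ} (hodd : Odd n) : qSum n ^ 2 = 2 ^ (n - 1) := by
  classical
  have hn : n ≠ 0 := hodd.pos.ne'
  have htr1 : tr n 1 = 1 := by
    apply (algebraMap (ZMod 2) (K n)).injective
    rw [algebraMap_tr hn, psum_one, map_one]
    obtain ⟨k, hk⟩ := hodd
    have : (n : K n) = ((2 * k + 1 : ℕ) : K n) := congrArg Nat.cast hk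
    rw [this]
    push_cast
    linear_combination (k : K n) * CharTwo.two_eq_zero (R := K n)
  have hcard : (Fintype.card (LinearMap.ker (tr n)) : ℤ) = 2 ^ (n - 1) := by
    have hrn := LinearMap.finrank_range_add_finrank_ker (tr n)
    have hr : LinearMap.range (tr n) = ⊤ := by
      rw [eq_top_iff]
      intro a _
      exact ⟨a • 1, by rw [map_smul, htr1, smul_eq_mul, mul_one]⟩
    rw [hr, finrank_top, Module.finrank_self, finrank_K hn] at hrn
    rw [Module.card_eq_pow_finrank (K := ZMod 2), ZMod.card]
    have : Module.finrank (ZMod 2) (LinearMap.ker (tr n)) = n - 1 := by omega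
    rw [this]
    push_cast
    rfl
  have h1 : ∀ x : LinearMap.ker (tr n), sgn (qf n x) * qSum n =
      ∑ z : LinearMap.ker (tr n), sgn (qf n z) * sgn (tr n (z * x)) := by
    intro x
    rw [qSum, Finset.mul_sum]
    symm
    refine Fintype.sum_equiv (Equiv.addRight x) _ _ fun z => ?_
    rw [← sgn_add, ← sgn_add]
    congr 1
    have hx0 : tr n x = 0 := x.2
    simp only [Equiv.coe_addRight, Submodule.coe_add, qf_add hn, hx0, mul_zero, add_zero]
    linear_combination -qf n x * CharTwo.two_eq_zero (R := ZMod 2)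
  have hcond : ∀ z : LinearMap.ker (tr n),
      (∀ w ∈ LinearMap.ker (tr n), tr n (z * w) = 0) ↔ z = 0 := by
    intro z
    refine ⟨fun h => Subtype.ext ?_, fun h => by simp [h]⟩
    refine (traceForm_nondegenerate (ZMod 2) (K n)).1 z.1 fun y => ?_
    have h2 := h (y - tr n y • 1) (by simp [htr1])
    have hz : tr n z = 0 := z.2
    rw [mul_sub, mul_smul_comm, mul_one, map_sub, map_smul, hz, smul_zero, sub_zero] at h2
    exact h2
  rw [← hcard, pow_two]
  nth_rewrite 1 [qSum]
  rw [Finset.sum_mul, Finset.sum_congr rfl fun x _ => h1 x, Finset.sum_comm]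
  simp_rw [← Finset.mul_sum, sum_sgn, hcond]
  simp [qf, Qf, sgn]

lemma qSum_one : qSum 1 = 1 := by
  have h : ∀ x : LinearMap.ker (tr 1), x = 0 := fun x => Subtype.ext (by
    have := (tr_eq_zero_iff one_ne_zero).mp x.2
    simpa [psum] using this)
  rw [qSum, Fintype.sum_eq_single 0 fun x hx => absurd (h x) hx]
  simp [qf, Qf, sgn]

open scoped NumberTheorySymbols in
lemma qSum_of_odd {n : ℕ} (hodd : Odd n) : qSum n = J(2 | n) * 2 ^ (n / 2) := by
  induction n using Nat.strong_induction_on with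
  | _ n ih =>
    by_cases h1 : n = 1
    · subst h1; simp [qSum_one]
    set p := n.minFac with hpdef
    have hpp : p.Prime := Nat.minFac_prime h1
    have : Fact p.Prime := ⟨hpp⟩
    obtain ⟨m, hm⟩ : ∃ m, n = m * p := ⟨n / p, (Nat.div_mul_cancel n.minFac_dvd).symm⟩
    rw [hm, Nat.odd_mul] at hodd
    obtain ⟨hmo, hpo⟩ := hodd
    have hm0 : m ≠ 0 := hmo.pos.ne'
    have hlt : m < n := by rw [hm]; exact lt_mul_of_one_lt_right hmo.pos hpp.one_lt
    have hmod := qSum_mul_modEq (p := p) hm0 hpo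
    have hsq := qSum_sq (hmo.mul hpo)
    rw [ih m hlt hmo] at hmod
    have hmz : NeZero m := ⟨hm0⟩
    have hpz : NeZero p := ⟨hpp.ne_zero⟩
    rw [hm, jacobiSym.mul_right]
    clear_value p
    obtain ⟨h, rfl⟩ := hpo
    obtain ⟨l, rfl⟩ := hmo
    have hk : (2 * l + 1) * (2 * h + 1) / 2 = h * (2 * l + 1) + l := by
      have : (2 * l + 1) * (2 * h + 1) = 2 * (h * (2 * l + 1) + l) + 1 := by ring
      omega
    have hk' : (2 * l + 1) * (2 * h + 1) - 1 = 2 * (h * (2 * l + 1) + l) := by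
      have : (2 * l + 1) * (2 * h + 1) = 2 * (h * (2 * l + 1) + l) + 1 := by ring
      omega
    have hl : (2 * l + 1) / 2 = l := by omega
    have hh : (2 * h + 1) / 2 = h := by omega
    have h2p : ¬ ((2 * h + 1 : ℕ) : ℤ) ∣ 2 := fun hd => by
      have := Int.le_of_dvd two_pos hd
      have := hpp.two_le
      push_cast at *
      omega
    have hpI : Prime ((2 * h + 1 : ℕ) : ℤ) := Nat.prime_iff_prime_int.mp hpp
    have ha : J(2 | 2 * l + 1) ^ 2 = 1 := jacobiSym.sq_one (by simp [Int.gcd])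
    have hb : J(2 | 2 * h + 1) ^ 2 = 1 := jacobiSym.sq_one (by simp [Int.gcd])
    have hpow : (2 : ℤ) ^ h ≡ J(2 | 2 * h + 1) [ZMOD (2 * h + 1 : ℕ)] := by
      rw [← ZMod.intCast_eq_intCast_iff, ← jacobiSym.legendreSym.to_jacobiSym, legendreSym.eq_pow,
        hh]
      push_cast
      rfl
    rw [hl] at hmod
    rw [hk]
    rw [hk'] at hsq
    generalize J(2 | 2 * l + 1) = a at *
    generalize J(2 | 2 * h + 1) = b at *
    generalize qSum ((2 * l + 1) * (2 * h + 1)) = q at *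
    have hcong : a * b * 2 ^ (h * (2 * l + 1) + l) ≡ q [ZMOD (2 * h + 1 : ℕ)] := by
      refine Int.ModEq.trans ?_ hmod.symm
      have h3 := ((hpow.pow (2 * l + 1)).mul_left (a * b)).mul_right (2 ^ l)
      have h4 : a * b * b ^ (2 * l + 1) * 2 ^ l = a * 2 ^ l := by
        rw [pow_succ, pow_mul, hb, one_pow]
        linear_combination a * 2 ^ l * hb
      rw [h4] at h3
      rw [pow_add, pow_mul, ← mul_assoc]
      exact h3
    have hsq' : q ^ 2 = (a * b * 2 ^ (h * (2 * l + 1) + l)) ^ 2 := by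
      rw [hsq, mul_pow, mul_pow, ha, hb, ← pow_mul, mul_comm 2]
      ring
    rcases sq_eq_sq_iff_eq_or_eq_neg.mp hsq' with h5 | h5
    · exact h5
    · exfalso
      rw [h5] at hcong
      have h6 : ((2 * h + 1 : ℕ) : ℤ) ∣ 2 * 2 ^ (h * (2 * l + 1) + l) := by
        obtain ⟨t, ht⟩ := hcong.symm.dvd
        refine ⟨a * b * t, ?_⟩
        have hab : (a * b) * (a * b) = 1 := by linear_combination b ^ 2 * ha + hb
        linear_combination (a * b) * ht - 2 * 2 ^ (h * (2 * l + 1) + l) * hab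
      rcases hpI.dvd_or_dvd h6 with h7 | h7
      · exact h2p h7
      · exact h2p (hpI.dvd_of_dvd_pow h7)

lemma qSum_neg_of_odd {n : ℕ} (h8 : n % 8 = 3 ∨ n % 8 = 5) : qSum n < 0 := by
  have hodd : Odd n := Nat.odd_iff.mpr (by omega)
  rw [qSum_of_odd hodd, jacobiSym.at_two hodd, ZMod.χ₈_nat_eq_if_mod_eight,
    if_neg (by omega), if_neg (by omega)]
  simp

lemma Qf_one_of_mod_four_eq_two {n : ℕ} (h4 : n % 4 = 2) : Qf n 1 = 1 := by
  obtain ⟨k, rfl⟩ : ∃ k, n = 2 + 4 * k := ⟨n / 4, by omega⟩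
  have h6 : qsum 4 (1 : K (2 + 4 * k)) = 6 := by
    simp only [qsum_succ, psum_succ, psum_zero, qsum_zero, one_pow]; norm_num
  have h2 : qsum 2 (1 : K (2 + 4 * k)) = 1 := by
    simp [qsum_succ, psum_succ]
  rw [Qf_eq_qsum, qsum_add, one_pow, qsum_mul_of_fixed (one_pow _), psum_one, psum_one, h6, h2]
  · push_cast
    linear_combination (7 * k) * CharTwo.two_eq_zero (R := K (2 + 4 * k))
  · rw [psum_one]
    push_cast
    linear_combination 2 * CharTwo.two_eq_zero (R := K (2 + 4 * k))

/-- The dimension bound for subspaces of the trace-zero hyperplane that are totally singular for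
`Qf`. -/
lemma finrank_le_of_totally_singular {n : ℕ} (hn : n ≠ 0) (W : Submodule (ZMod 2) (K n))
    (hW : ∀ w ∈ W, tr n w = 0 ∧ Qf n w = 0) :
    Module.finrank (ZMod 2) W ≤
      if n % 8 = 1 ∨ n % 8 = 7 then (n - 1) / 2
      else if n % 8 = 3 ∨ n % 8 = 5 then (n - 3) / 2
      else if n % 8 = 4 then n / 2
      else (n - 2) / 2 := by
  have hq : ∀ w ∈ W, qf n w = 0 := fun w hw => qf_eq_zero_iff.mpr (hW w hw).2
  have hiso : ∀ x ∈ W, ∀ y ∈ W, tr n (x * y) = 0 := by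
    intro x hx y hy
    have h := qf_add hn x y
    rw [hq _ (W.add_mem hx hy), hq x hx, hq y hy, (hW x hx).1] at h
    simpa using h.symm
  have hle := two_mul_finrank_le hn W hiso
  have hmax : n ≤ 2 * Module.finrank (ZMod 2) W + 1 → 0 < qSum n := by
    intro hd
    have h := qSum_mul_sgn_pos hn W 0 (map_zero _) (fun w hw => (hW w hw).1)
      (fun w hw => by rw [hq w hw, zero_mul, map_zero]) (fun x hx hxw => by
        rw [hq _ (W.zero_mem)]
        refine hq x (mem_of_tr_mul_eq_zero hn W hiso hd x hx fun w hw => ?_)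
        simpa using hxw w hw)
    rw [hq _ (W.zero_mem)] at h
    simpa [sgn] using h
  split_ifs with h1 h3 h4
  · omega
  · by_contra hcon
    exact absurd (hmax (by omega)) (qSum_neg_of_odd h3).le.not_gt
  · omega
  · by_contra hcon
    have hd : n ≤ 2 * Module.finrank (ZMod 2) W + 1 := by omega
    by_cases h0 : n % 8 = 0
    · exact absurd (hmax hd) (qSum_neg_of_mod_eight_eq_zero hn h0).le.not_gt
    · have htr1 : tr n 1 = 0 := by
        rw [tr_eq_zero_iff hn, psum_one, CharP.cast_eq_zero_iff (K n) 2]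
        omega
      have h1W := mem_of_tr_mul_eq_zero hn W hiso hd 1 htr1 fun w hw => by
        rw [one_mul]; exact (hW w hw).1
      have h := (hW 1 h1W).2
      rw [Qf_one_of_mod_four_eq_two (by omega)] at h
      exact one_ne_zero h

theorem stmt13 {n : ℕ} (hn : 4 ≤ n)
    (hchar : ∀ a : K n, (16 : ℤ) ∣ Kl n a ↔ (tr n a = 0 ∧ Qf n a = 0))
    (W : Submodule (ZMod 2) (K n)) (hW : ∀ w ∈ W, (16 : ℤ) ∣ Kl n w) :
    Module.finrank (ZMod 2) W ≤
      if n % 8 = 1 ∨ n % 8 = 7 then (n - 1) / 2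
      else if n % 8 = 3 ∨ n % 8 = 5 then (n - 3) / 2
      else if n % 8 = 4 then n / 2
      else (n - 2) / 2 := by
  exact finrank_le_of_totally_singular (by omega) W fun w hw => (hchar w).mp (hW w hw)
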